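/- Fix integers k > ℓ ≥ 3. For every ε > 0 there exists N such that for all n ≥ N, γ(G_{k,ℓ}) ≤ C(n,ℓ) · (1 − ((k−ℓ)/(k−ℓ+1))·(1 − 1/ℓ)^{ℓ−1} + ε). -/

import Mathlib

/-- `(E, K)` is a dominating set of the bipartite graph `G_{k,l}` whose vertex
classes are the `k`-element and `l`-element subsets of `[n] = {1, …, n}`
(modelled as `Finset.range n`), a `k`-set `A` being adjacent to an `l`-set `B`
iff `B ⊆ A`. -/
def IsDomSet (n k l : ℕ) (E K : Finset (Finset ℕ)) : Prop :=
  (∀ e ∈ E, e ⊆ Finset.range n ∧ e.card = l) ∧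
  (∀ A ∈ K, A ⊆ Finset.range n ∧ A.card = k) ∧
  (∀ A, A ⊆ Finset.range n → A.card = k → A ∉ K → ∃ e ∈ E, e ⊆ A) ∧
  (∀ e, e ⊆ Finset.range n → e.card = l → e ∉ E → ∃ A ∈ K, e ⊆ A)

/-- The domination number `γ(G_{k,l})`: the minimum of `|E| + |K|` over all
dominating sets `(E, K)` of `G_{k,l}`. -/
noncomputable def gamma (n k l : ℕ) : ℕ :=
  sInf {m | ∃ E K : Finset (Finset ℕ), IsDomSet n k l E K ∧ m = E.card + K.card}

open Finset in
/-- The construction for `k = s + r`, `l = s + 1`: with `X = {0, …, m - 1}`, `E` consists of the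
`l`-sets that do not meet `X` in exactly one point, and `K` of the unions of an `s`-set outside `X`
with one of `m / r + 1` blocks of size `r` covering `X`. -/
theorem gamma_add_le {n m s r : ℕ} (hs : 1 ≤ s) (hr : 2 ≤ r) (hrm : r ≤ m) (hmn : m ≤ n) :
    gamma n (s + r) (s + 1) + (n - m).choose s * m ≤
      n.choose (s + 1) + (n - m).choose s * (m / r + 1) := by
  classical
  let block : ℕ → Finset ℕ := fun i => Ico (min (i * r) (m - r)) (min (i * r) (m - r) + r)
  let E := (powersetCard (s + 1) (range n)).filter fun e => #(e.filter (· < m)) ≠ 1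
  let H := (powersetCard (s + 1) (range n)).filter fun e => #(e.filter (· < m)) = 1
  let K := image (fun p : Finset ℕ × ℕ => p.1 ∪ block p.2)
    (powersetCard s (Ico m n) ×ˢ range (m / r + 1))
  have block_lt : ∀ i, ∀ x ∈ block i, x < m := by
    intro i x hx
    have := (mem_Ico.1 hx).2
    omega
  have hH : (n - m).choose s * m ≤ #H := by
    have hcard : #(powersetCard s (Ico m n) ×ˢ range m) = (n - m).choose s * m := by simp
    rw [← hcard]
    refine card_le_card_of_injOn (fun p => insert p.2 p.1) ?_ ?_
    · rintro ⟨S, x⟩ hp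
      simp only [coe_product, Set.mem_prod, mem_coe, mem_powersetCard, mem_range] at hp
      obtain ⟨⟨hS, hSc⟩, hx⟩ := hp
      have hge : ∀ y ∈ S, m ≤ y ∧ y < n := fun y hy => mem_Ico.1 (hS hy)
      have hxS : x ∉ S := fun h => by have := hge x h; omega
      have hfilter : (insert x S).filter (· < m) = {x} := by
        ext y
        simp only [mem_filter, mem_insert, mem_singleton]
        constructor
        · rintro ⟨rfl | h, h'⟩
          · rfl
          · have := hge y h; omega
        · rintro rfl
          exact ⟨Or.inl rfl, hx⟩
      simp only [H, mem_coe, mem_filter, mem_powersetCard, hfilter, card_singleton, and_true,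
        card_insert_of_notMem hxS, hSc]
      intro y hy
      rcases mem_insert.1 hy with rfl | hy
      · exact mem_range.2 (by omega)
      · exact mem_range.2 (hge y hy).2
    · rintro ⟨S, x⟩ hp ⟨T, y⟩ hq h
      simp only [coe_product, Set.mem_prod, mem_coe, mem_powersetCard, mem_range] at hp hq h
      obtain ⟨⟨hS, -⟩, hx⟩ := hp
      obtain ⟨⟨hT, -⟩, hy⟩ := hq
      have hgeS : ∀ z ∈ S, m ≤ z := fun z hz => (mem_Ico.1 (hS hz)).1
      have hgeT : ∀ z ∈ T, m ≤ z := fun z hz => (mem_Ico.1 (hT hz)).1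
      have hmem : ∀ z, (z = x ∨ z ∈ S) ↔ (z = y ∨ z ∈ T) := fun z => by
        rw [← mem_insert, ← mem_insert, h]
      have hxy : x = y := by
        rcases (hmem x).1 (Or.inl rfl) with h | h
        · exact h
        · have := hgeT x h; omega
      have hST : S = T := by
        ext z
        constructor
        · intro hz
          rcases (hmem z).1 (Or.inr hz) with h | h
          · have := hgeS z hz; omega
          · exact h
        · intro hz
          rcases (hmem z).2 (Or.inr hz) with h | h
          · have := hgeT z hz; omega
          · exact h
      rw [hxy, hST]
  have hEH : #H + #E = n.choose (s + 1) := by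
    simpa [H, E] using card_filter_add_card_filter_not (s := powersetCard (s + 1) (range n))
      (fun e => #(e.filter (· < m)) = 1)
  have hK : #K ≤ (n - m).choose s * (m / r + 1) := by
    refine card_image_le.trans ?_
    simp
  have hdom : IsDomSet n (s + r) (s + 1) E K := by
    refine ⟨fun e he => ?_, fun A hA => ?_, fun A hA hAc _ => ?_, fun e he hec heE => ?_⟩
    · exact mem_powersetCard.1 (mem_filter.1 he).1
    · obtain ⟨⟨S, i⟩, hp, rfl⟩ := mem_image.1 hA
      obtain ⟨hS, -⟩ := mem_product.1 hp
      obtain ⟨hS, hSc⟩ := mem_powersetCard.1 hS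
      have hdisj : Disjoint S (block i) := by
        rw [disjoint_left]
        intro x hx hx'
        have := (mem_Ico.1 (hS hx)).1
        have := block_lt i x hx'
        omega
      refine ⟨fun x hx => ?_, ?_⟩
      · rcases mem_union.1 hx with hx | hx
        · exact mem_range.2 (mem_Ico.1 (hS hx)).2
        · exact mem_range.2 ((block_lt i x hx).trans_le hmn)
      · simp [card_union_of_disjoint hdisj, hSc, block]
    · by_cases h2 : 2 ≤ #(A.filter (· < m))
      · obtain ⟨T, hT, hTc⟩ := exists_subset_card_eq h2
        obtain ⟨e, hTe, heA, hec⟩ := exists_subsuperset_card_eq (n := s + 1)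
          (hT.trans (filter_subset _ _)) (by omega) (by omega)
        refine ⟨e, mem_filter.2 ⟨mem_powersetCard.2 ⟨heA.trans hA, hec⟩, ?_⟩, heA⟩
        have : #T ≤ #(e.filter (· < m)) :=
          card_le_card fun x hx => mem_filter.2 ⟨hTe hx, (mem_filter.1 (hT hx)).2⟩
        omega
      · have hsum := card_filter_add_card_filter_not (s := A) (· < m)
        obtain ⟨e, he, hec⟩ := exists_subset_card_eq (s := A.filter (¬ · < m)) (n := s + 1)
          (by omega)
        have heA := he.trans (filter_subset _ _)
        refine ⟨e, mem_filter.2 ⟨mem_powersetCard.2 ⟨heA.trans hA, hec⟩, ?_⟩, heA⟩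
        rw [filter_false_of_mem fun x hx => (mem_filter.1 (he hx)).2]
        simp
    · have hone : #(e.filter (· < m)) = 1 := by
        by_contra h
        exact heE (mem_filter.2 ⟨mem_powersetCard.2 ⟨he, hec⟩, h⟩)
      have hsum := card_filter_add_card_filter_not (s := e) (· < m)
      obtain ⟨x, hx⟩ := card_eq_one.1 hone
      have hxm : x < m := by
        have : x ∈ e.filter (· < m) := hx ▸ mem_singleton_self x
        exact (mem_filter.1 this).2
      have hfar : #(e.filter (¬ · < m)) = s := by omega
      refine ⟨e.filter (¬ · < m) ∪ block (x / r), mem_image.2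
        ⟨(e.filter (¬ · < m), x / r), mem_product.2 ⟨mem_powersetCard.2 ⟨?_, hfar⟩, ?_⟩, rfl⟩,
        ?_⟩
      · intro y hy
        obtain ⟨hy, hym⟩ := mem_filter.1 hy
        exact mem_Ico.2 ⟨not_lt.1 hym, mem_range.1 (he hy)⟩
      · exact mem_range.2 (Nat.lt_succ_of_le (Nat.div_le_div_right hxm.le))
      · intro y hy
        by_cases hym : y < m
        · obtain rfl : y = x := mem_singleton.1 (hx ▸ mem_filter.2 ⟨hy, hym⟩)
          have h1 := Nat.div_mul_le_self y r
          have h2 := Nat.lt_div_mul_add (a := y) (b := r) (by omega)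
          exact mem_union_right _ (mem_Ico.2 ⟨by omega, by omega⟩)
        · exact mem_union_left _ (mem_filter.2 ⟨hy, hym⟩)
  have hgamma : gamma n (s + r) (s + 1) ≤ #E + #K := Nat.sInf_le ⟨E, K, hdom, rfl⟩
  omega

open Filter Topology in
theorem eventually_choose_mul_le {s : ℕ} (hs : 1 ≤ s) {a ε : ℝ} (ha : 0 < a) (ha1 : a ≤ 1)
    (hε : 0 < ε) :
    ∀ᶠ n : ℕ in atTop,
      (n.choose (s + 1) : ℝ) * (a * (1 - 1 / ((s + 1 : ℕ) : ℝ)) ^ s - ε) ≤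
        ((n - n / (s + 1)).choose s : ℝ) * (((n / (s + 1) : ℕ) : ℝ) * a - 1) := by
  set l : ℝ := ((s + 1 : ℕ) : ℝ) with hl
  have hl2 : 2 ≤ l := by rw [hl]; exact_mod_cast Nat.succ_le_succ hs
  have hl0 : 0 < l := by linarith
  have hb : 0 < 1 - 1 / l := by
    rw [sub_pos, div_lt_one hl0]; linarith
  have hdiv : ∀ c : ℝ, Tendsto (fun n : ℕ => c / (n : ℝ)) atTop (𝓝 0) :=
    tendsto_const_div_atTop_nhds_zero_nat
  have hlim₁ : Tendsto (fun n : ℕ => 1 - 1 / l - l / (n : ℝ)) atTop (𝓝 (1 - 1 / l)) := by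
    simpa using tendsto_const_nhds.sub (hdiv l)
  have hlim₂ : Tendsto (fun n : ℕ => a - 2 * l / (n : ℝ)) atTop (𝓝 a) := by
    simpa using tendsto_const_nhds.sub (hdiv (2 * l))
  have hlim := hlim₂.mul (hlim₁.pow s)
  filter_upwards [hlim₁.eventually_const_lt hb, hlim₂.eventually_const_lt ha,
    hlim.eventually_const_lt (sub_lt_self _ hε), eventually_gt_atTop 0] with n h₁ h₂ h₃ hn
  have hn0 : (0 : ℝ) < n := by exact_mod_cast hn
  set m := n / (s + 1) with hm
  have hml : (m : ℝ) ≤ n / l := Nat.cast_div_le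
  have hmg : (n : ℝ) / l - 1 ≤ m := by
    have : n < (m + 1) * (s + 1) := by
      have := Nat.lt_div_mul_add (a := n) (b := s + 1) (by omega)
      rwa [add_mul, one_mul]
    have : (n : ℝ) < (m + 1) * l := by rw [hl]; exact_mod_cast this
    have := (div_lt_iff₀ hl0).2 this
    linarith
  have hbase : (n : ℝ) * (1 - 1 / l - l / n) ≤ ((n - m + 1 - s : ℕ) : ℝ) := by
    have h : n ≤ (n - m + 1 - s) + m + (s + 1) := by omega
    have h : (n : ℝ) ≤ ((n - m + 1 - s : ℕ) : ℝ) + m + l := by rw [hl]; exact_mod_cast h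
    have : (n : ℝ) * (1 - 1 / l - l / n) = n - n / l - l := by field_simp
    linarith
  have hP : ((n : ℝ) * (1 - 1 / l - l / n)) ^ s / (s.factorial : ℝ) ≤ (n - m).choose s := by
    refine le_trans ?_ (Nat.pow_le_choose s (n - m))
    gcongr
  have hM : (n : ℝ) / l * (a - 2 * l / n) ≤ m * a - 1 := by
    have : (n : ℝ) / l * (a - 2 * l / n) = n / l * a - 2 := by field_simp
    have := mul_le_mul_of_nonneg_right hmg ha.le
    linarith
  have hQ : (n.choose (s + 1) : ℝ) ≤ (n : ℝ) ^ (s + 1) / ((s + 1).factorial : ℝ) :=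
    Nat.choose_le_pow_div _ _
  have hfac : ((s + 1).factorial : ℝ) = l * s.factorial := by
    rw [Nat.factorial_succ, Nat.cast_mul]
  calc (n.choose (s + 1) : ℝ) * (a * (1 - 1 / l) ^ s - ε)
      ≤ n.choose (s + 1) * ((a - 2 * l / n) * (1 - 1 / l - l / n) ^ s) := by gcongr
    _ ≤ (n : ℝ) ^ (s + 1) / ((s + 1).factorial : ℝ) *
          ((a - 2 * l / n) * (1 - 1 / l - l / n) ^ s) := by gcongr
    _ = ((n : ℝ) * (1 - 1 / l - l / n)) ^ s / (s.factorial : ℝ) *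
          ((n : ℝ) / l * (a - 2 * l / n)) := by
        rw [hfac, mul_pow, pow_succ, div_mul_eq_mul_div, div_mul_eq_mul_div, div_mul_eq_mul_div,
          mul_div_assoc', div_div]
        ring
    _ ≤ _ := by gcongr

/-- For fixed `k > l ≥ 3`,
`γ(G_{k,l}) ≤ C(n,l)·(1 - ((k-l)/(k-l+1))·(1 - 1/l)^(l-1) + o(1))`. -/
theorem domination_number_Gkl_upper (k l : ℕ) (hl : 3 ≤ l) (hkl : l < k)
    (ε : ℝ) (hε : 0 < ε) :
    ∃ N : ℕ, ∀ n : ℕ, N ≤ n →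
      (gamma n k l : ℝ) ≤ (n.choose l : ℝ) *
        (1 - (((k : ℝ) - (l : ℝ)) / ((k : ℝ) - (l : ℝ) + 1)) * (1 - 1 / (l : ℝ)) ^ (l - 1) + ε) := by
  obtain ⟨s, rfl⟩ : ∃ s, l = s + 1 := ⟨l - 1, by omega⟩
  obtain ⟨r, rfl⟩ : ∃ r, k = s + r := ⟨k - s, by omega⟩
  have hr : 2 ≤ r := by omega
  have hr2 : (2 : ℝ) ≤ r := by exact_mod_cast hr
  have hr0 : (0 : ℝ) < r := by linarith
  have hfrac : (((s + r : ℕ) : ℝ) - ((s + 1 : ℕ) : ℝ)) / (((s + r : ℕ) : ℝ) - ((s + 1 : ℕ) : ℝ) + 1)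
      = 1 - 1 / (r : ℝ) := by
    have h : ((s + r : ℕ) : ℝ) - ((s + 1 : ℕ) : ℝ) = r - 1 := by push_cast; ring
    rw [h, sub_add_cancel, sub_div, div_self hr0.ne']
  rw [hfrac, Nat.add_sub_cancel]
  have ha : 0 < 1 - 1 / (r : ℝ) := by
    rw [sub_pos, div_lt_one hr0]; linarith
  have ha1 : 1 - 1 / (r : ℝ) ≤ 1 := sub_le_self _ (by positivity)
  obtain ⟨N, hN⟩ := Filter.eventually_atTop.1
    (eventually_choose_mul_le (s := s) (by omega) ha ha1 hε)
  refine ⟨max N (r * (s + 1)), fun n hn => ?_⟩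
  have hrm : r ≤ n / (s + 1) :=
    (Nat.le_div_iff_mul_le (by omega)).2 ((le_max_right _ _).trans hn)
  have hbound := hN n ((le_max_left _ _).trans hn)
  have hgamma := gamma_add_le (by omega : 1 ≤ s) hr hrm (Nat.div_le_self n (s + 1))
  set m := n / (s + 1)
  have hgamma : (gamma n (s + r) (s + 1) : ℝ) + (n - m).choose s * m ≤
      n.choose (s + 1) + (n - m).choose s * ((m / r : ℕ) + 1) := by exact_mod_cast hgamma
  have hfloor : ((m / r : ℕ) : ℝ) ≤ m / r := Nat.cast_div_le
  have hmul := mul_le_mul_of_nonneg_left hfloor (Nat.cast_nonneg (α := ℝ) ((n - m).choose s))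
  have hexp : ((n - m).choose s : ℝ) * ((m : ℝ) * (1 - 1 / r) - 1) =
      (n - m).choose s * m - (n - m).choose s * (m / r) - (n - m).choose s := by ring
  linarith
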